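/- There exists a universal constant C ≥ 0 such that for every finite bipartite instance with capacities c : I → ℕ satisfying c_min := min_{i∈I} c_i ≥ 2, one has OPT(LP)·(1 − C·√(log c_min / c_min)) ≤ OPT(PBP) ≤ OPT(LP). In particular, as c_min → ∞ the two optima coincide asymptotically. -/

import Mathlib

open Finset

variable {I T : Type*}

/-- Probability of a sample path `ω : E → Bool` under the product measure where
edge `e` succeeds independently with probability `p e`. -/
noncomputable def pathWeight [Fintype I] [DecidableEq I] [Fintype T] [LinearOrder T]
    (E : Finset (I × T)) (p : I × T → ℝ) (ω : ↥E → Bool) : ℝ :=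
  ∏ e : ↥E, if ω e then p e.val else 1 - p e.val

/-- Expectation over sample paths `ω : E → Bool`. -/
noncomputable def pExp [Fintype I] [DecidableEq I] [Fintype T] [LinearOrder T]
    (E : Finset (I × T)) (p : I × T → ℝ) (f : (↥E → Bool) → ℝ) : ℝ :=
  ∑ ω : ↥E → Bool, pathWeight E p ω * f ω

/-- The optimal value `OPT(LP)` of the expectation LP with capacities `c`. -/
noncomputable def lpOpt [Fintype I] [DecidableEq I] [Fintype T] [LinearOrder T]
    (E : Finset (I × T)) (p : I × T → ℝ) (r : I → ℝ) (c : I → ℕ) : ℝ :=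
  sSup { v : ℝ | ∃ x : ↥E → ℝ,
    (∀ e, 0 ≤ x e ∧ x e ≤ 1) ∧
    (∀ i : I, ∑ e ∈ univ.filter (fun e : ↥E => e.val.1 = i), p e.val * x e ≤ (c i : ℝ)) ∧
    (∀ t : T, ∑ e ∈ univ.filter (fun e : ↥E => e.val.2 = t), x e ≤ 1) ∧
    v = ∑ e : ↥E, p e.val * r e.val.1 * x e }

/-- The optimal value `OPT(PBP)` of the path-based program with capacities `c`:
the supremum of the expected reward over feasible nonanticipative families. -/
noncomputable def pbpOpt [Fintype I] [DecidableEq I] [Fintype T] [LinearOrder T]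
    (E : Finset (I × T)) (p : I × T → ℝ) (r : I → ℝ) (c : I → ℕ) : ℝ :=
  sSup { v : ℝ | ∃ x : ↥E → (↥E → Bool) → ℝ,
    (∀ e ω, 0 ≤ x e ω ∧ x e ω ≤ 1) ∧
    (∀ (e : ↥E) (ω ω' : ↥E → Bool),
      (∀ e' : ↥E, e'.val.2 < e.val.2 → ω e' = ω' e') → x e ω = x e ω') ∧
    (∀ (i : I) (ω : ↥E → Bool),
      ∑ e ∈ univ.filter (fun e : ↥E => e.val.1 = i),
        x e ω * (if ω e then (1 : ℝ) else 0) ≤ (c i : ℝ)) ∧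
    (∀ (t : T) (ω : ↥E → Bool),
      ∑ e ∈ univ.filter (fun e : ↥E => e.val.2 = t), x e ω ≤ 1) ∧
    v = pExp E p (fun ω => ∑ e : ↥E, r e.val.1 * x e ω * (if ω e then (1 : ℝ) else 0)) }

section PathExpectation

variable [Fintype I] [DecidableEq I] [Fintype T] [LinearOrder T]

theorem pExp_add (E : Finset (I × T)) (p : I × T → ℝ) (f g : (↥E → Bool) → ℝ) :
    pExp E p (fun ω => f ω + g ω) = pExp E p f + pExp E p g := by
  simp only [pExp, mul_add, sum_add_distrib]

theorem pExp_const_mul (E : Finset (I × T)) (p : I × T → ℝ) (a : ℝ) (f : (↥E → Bool) → ℝ) :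
    pExp E p (fun ω => a * f ω) = a * pExp E p f := by
  simp only [pExp, mul_sum]
  exact sum_congr rfl fun ω _ => by ring

theorem pExp_sum {α : Type*} (E : Finset (I × T)) (p : I × T → ℝ) (s : Finset α)
    (f : α → (↥E → Bool) → ℝ) :
    pExp E p (fun ω => ∑ a ∈ s, f a ω) = ∑ a ∈ s, pExp E p (f a) := by
  simp only [pExp, mul_sum]
  exact sum_comm

theorem sum_pathWeight (E : Finset (I × T)) (p : I × T → ℝ) :
    ∑ ω, pathWeight E p ω = 1 := by
  have h := Fintype.prod_sum (fun (e : ↥E) (b : Bool) => if b then p e.val else 1 - p e.val)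
  simp only [pathWeight, ← h]
  simp

theorem pExp_const (E : Finset (I × T)) (p : I × T → ℝ) (a : ℝ) :
    pExp E p (fun _ => a) = a := by
  simp only [pExp, ← sum_mul, sum_pathWeight, one_mul]

theorem pathWeight_nonneg {E : Finset (I × T)} {p : I × T → ℝ}
    (hp : ∀ e ∈ E, 0 ≤ p e ∧ p e ≤ 1) (ω : ↥E → Bool) : 0 ≤ pathWeight E p ω := by
  refine prod_nonneg fun e _ => ?_
  have := hp e.val e.property
  split_ifs <;> linarith

theorem pExp_mono {E : Finset (I × T)} {p : I × T → ℝ}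
    (hp : ∀ e ∈ E, 0 ≤ p e ∧ p e ≤ 1) {f g : (↥E → Bool) → ℝ} (h : ∀ ω, f ω ≤ g ω) :
    pExp E p f ≤ pExp E p g :=
  sum_le_sum fun ω _ => mul_le_mul_of_nonneg_left (h ω) (pathWeight_nonneg hp ω)

/-- A centered coordinate is orthogonal to every function not depending on it. -/
theorem pExp_mul_centered (E : Finset (I × T)) (p : I × T → ℝ) (e : ↥E)
    (f : (↥E → Bool) → ℝ) (hf : ∀ ω b, f (Function.update ω e b) = f ω) :
    pExp E p (fun ω => f ω * ((if ω e then (1 : ℝ) else 0) - p e.val)) = 0 := by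
  refine sum_involution (fun ω _ => Function.update ω e (!ω e)) ?_ ?_ ?_ ?_
  · intro ω _
    have hw : ∀ ω' : ↥E → Bool, pathWeight E p ω' =
        (if ω' e then p e.val else 1 - p e.val) *
          ∏ e' ∈ univ.erase e, if ω' e' then p e'.val else 1 - p e'.val :=
      fun ω' => (mul_prod_erase univ _ (mem_univ e)).symm
    have hrest : (∏ e' ∈ univ.erase e,
          if Function.update ω e (!ω e) e' then p e'.val else 1 - p e'.val) =
        ∏ e' ∈ univ.erase e, if ω e' then p e'.val else 1 - p e'.val :=
      prod_congr rfl fun e' he' => by rw [Function.update_of_ne (ne_of_mem_erase he')]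
    rw [hw, hw (Function.update ω e _), hrest]
    simp only [hf, Function.update_self]
    cases ω e <;> simp <;> ring
  · intro ω _ _ h
    have := congrFun h e
    simp at this
  · intro ω _
    exact mem_univ _
  · intro ω _
    simp

theorem pExp_mul_indicator (E : Finset (I × T)) (p : I × T → ℝ) (e : ↥E)
    (f : (↥E → Bool) → ℝ) (hf : ∀ ω b, f (Function.update ω e b) = f ω) :
    pExp E p (fun ω => f ω * (if ω e then (1 : ℝ) else 0)) = p e.val * pExp E p f := by
  have h := pExp_mul_centered E p e f hf
  have hsplit : ∀ ω : ↥E → Bool, f ω * (if ω e then (1 : ℝ) else 0) =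
      f ω * ((if ω e then (1 : ℝ) else 0) - p e.val) + p e.val * f ω := fun ω => by ring
  simp only [hsplit]
  rw [pExp_add, h, zero_add, pExp_const_mul]

theorem pExp_indicator (E : Finset (I × T)) (p : I × T → ℝ) (e : ↥E) :
    pExp E p (fun ω => if ω e then (1 : ℝ) else 0) = p e.val := by
  have h := pExp_mul_indicator E p e (fun _ => 1) (fun _ _ => rfl)
  simpa [pExp_const] using h

theorem pExp_weighted_sum (E : Finset (I × T)) (p : I × T → ℝ) (s : Finset ↥E) (y : ↥E → ℝ) :
    pExp E p (fun ω => ∑ e ∈ s, y e * (if ω e then (1 : ℝ) else 0)) =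
      ∑ e ∈ s, p e.val * y e := by
  rw [pExp_sum]
  refine sum_congr rfl fun e _ => ?_
  rw [pExp_const_mul, pExp_indicator, mul_comm]

/-- The variance of a weighted sum of independent indicators. -/
theorem pExp_weighted_sum_sub_sq (E : Finset (I × T)) (p : I × T → ℝ) (s : Finset ↥E)
    (y : ↥E → ℝ) :
    pExp E p (fun ω => (∑ e ∈ s, y e * (if ω e then (1 : ℝ) else 0) -
        ∑ e ∈ s, p e.val * y e) ^ 2) =
      ∑ e ∈ s, y e ^ 2 * (p e.val * (1 - p e.val)) := by
  have hexp : ∀ ω : ↥E → Bool, (∑ e ∈ s, y e * (if ω e then (1 : ℝ) else 0) -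
        ∑ e ∈ s, p e.val * y e) ^ 2 =
      ∑ e ∈ s, ∑ e' ∈ s, (y e * y e') * (((if ω e then (1 : ℝ) else 0) - p e.val) *
        ((if ω e' then (1 : ℝ) else 0) - p e'.val)) := by
    intro ω
    rw [← sum_sub_distrib, sq, sum_mul_sum]
    exact sum_congr rfl fun e _ => sum_congr rfl fun e' _ => by ring
  simp only [hexp, pExp_sum, pExp_const_mul]
  refine sum_congr rfl fun e he => ?_
  rw [sum_eq_single_of_mem e he]
  · have hsq : ∀ ω : ↥E → Bool, ((if ω e then (1 : ℝ) else 0) - p e.val) *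
          ((if ω e then (1 : ℝ) else 0) - p e.val) =
        (1 - 2 * p e.val) * ((if ω e then (1 : ℝ) else 0) - p e.val) +
          p e.val * (1 - p e.val) := by
      intro ω
      cases ω e <;> simp <;> ring
    simp only [hsq]
    rw [pExp_add, pExp_mul_centered E p e (fun _ => 1 - 2 * p e.val) (fun _ _ => rfl),
      pExp_const]
    ring
  · intro e' _ hne
    rw [pExp_mul_centered E p e' (fun ω => (if ω e then (1 : ℝ) else 0) - p e.val), mul_zero]
    intro ω b
    rw [Function.update_of_ne hne.symm]

end PathExpectation

section Truncation

variable {α : Type*} [LinearOrder T] (s : Finset α) (key : α → T) (z : α → ℝ) (c : ℝ)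

/-- Serving requests only while at most `c - 1` has been requested before uses at most `c`. -/
theorem truncated_sum_le (hkey : Set.InjOn key s) (hz : ∀ a ∈ s, 0 ≤ z a ∧ z a ≤ 1)
    (hc : 0 ≤ c) :
    ∑ a ∈ s, (if ∑ b ∈ s with key b < key a, z b ≤ c - 1 then z a else 0) ≤ c := by
  classical
  rw [← sum_filter]
  rcases (s.filter fun a => ∑ b ∈ s with key b < key a, z b ≤ c - 1).eq_empty_or_nonempty
    with h | h
  · simpa [h] using hc
  · obtain ⟨a, ha, hmax⟩ := exists_max_image _ key h
    rw [mem_filter] at ha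
    calc _ ≤ ∑ b ∈ insert a (s.filter fun b => key b < key a), z b := by
          refine sum_le_sum_of_subset_of_nonneg ?_ ?_
          · intro b hb
            have hle := hmax b hb
            have hbs := (mem_filter.1 hb).1
            rcases hle.eq_or_lt with h' | h'
            · exact mem_insert.2 (Or.inl (hkey hbs ha.1 h'))
            · exact mem_insert_of_mem (mem_filter.2 ⟨hbs, h'⟩)
          · intro b hb _
            rcases mem_insert.1 hb with rfl | hb
            · exact (hz _ ha.1).1
            · exact (hz _ (mem_filter.1 hb).1).1
      _ = z a + ∑ b ∈ s with key b < key a, z b := sum_insert (by simp)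
      _ ≤ c := by linarith [(hz a ha.1).2, ha.2]

/-- Serving requests only while at most `c - 1` has been requested before uses at least the
smaller of the total request and `c - 1`. -/
theorem min_le_truncated_sum (hz : ∀ a ∈ s, 0 ≤ z a) :
    min (∑ a ∈ s, z a) (c - 1) ≤
      ∑ a ∈ s, (if ∑ b ∈ s with key b < key a, z b ≤ c - 1 then z a else 0) := by
  classical
  by_cases hall : ∀ a ∈ s, ∑ b ∈ s with key b < key a, z b ≤ c - 1
  · refine (min_le_left _ _).trans (le_of_eq ?_)
    exact sum_congr rfl fun a ha => (if_pos (hall a ha)).symm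
  · push Not at hall
    obtain ⟨a₀, ha₀, hfail⟩ := hall
    obtain ⟨a, ha, hmin⟩ := exists_min_image
      (s.filter fun a => c - 1 < ∑ b ∈ s with key b < key a, z b) key
      ⟨a₀, mem_filter.2 ⟨ha₀, hfail⟩⟩
    refine (min_le_right _ _).trans ((mem_filter.1 ha).2.le.trans ?_)
    rw [← sum_filter]
    refine sum_le_sum_of_subset_of_nonneg ?_ fun b hb _ => hz b (mem_filter.1 hb).1
    intro b hb
    rw [mem_filter] at hb ⊢
    refine ⟨hb.1, ?_⟩
    by_contra hcon
    exact absurd (hmin b (mem_filter.2 ⟨hb.1, not_le.1 hcon⟩)) (not_le.2 hb.2)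

end Truncation

theorem sub_sq_div_le_min {S m q a : ℝ} (hq : 0 < q) (ha : m + q ≤ a) :
    S - (S - m) ^ 2 / (4 * q) ≤ min S a := by
  have h0 : 0 ≤ (S - m) ^ 2 / (4 * q) := by positivity
  refine le_min (by linarith) ?_
  have : S - m - q ≤ (S - m) ^ 2 / (4 * q) := by
    rw [le_div_iff₀ (by positivity)]
    nlinarith [sq_nonneg (S - m - 2 * q)]
  linarith

section Programs

variable [DecidableEq I] [LinearOrder T]

/-- The set of objective values of feasible LP solutions. -/
def lpValues (E : Finset (I × T)) (p : I × T → ℝ) (r : I → ℝ) (c : I → ℕ) : Set ℝ :=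
  { v : ℝ | ∃ x : ↥E → ℝ,
    (∀ e, 0 ≤ x e ∧ x e ≤ 1) ∧
    (∀ i : I, ∑ e ∈ univ.filter (fun e : ↥E => e.val.1 = i), p e.val * x e ≤ (c i : ℝ)) ∧
    (∀ t : T, ∑ e ∈ univ.filter (fun e : ↥E => e.val.2 = t), x e ≤ 1) ∧
    v = ∑ e : ↥E, p e.val * r e.val.1 * x e }

variable {E : Finset (I × T)} {p : I × T → ℝ} {r : I → ℝ} {c : I → ℕ}

theorem zero_mem_lpValues : (0 : ℝ) ∈ lpValues E p r c :=
  ⟨fun _ => 0, by simp, by simp, by simp, by simp⟩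

theorem bddAbove_lpValues (hp : ∀ e ∈ E, 0 ≤ p e ∧ p e ≤ 1) (hr : ∀ i, 0 ≤ r i) :
    BddAbove (lpValues E p r c) := by
  refine ⟨∑ e : ↥E, p e.val * r e.val.1, ?_⟩
  rintro v ⟨x, hx, -, -, rfl⟩
  exact sum_le_sum fun e _ => mul_le_of_le_one_right
    (mul_nonneg (hp e.val e.property).1 (hr _)) (hx e).2

variable [Fintype I] [Fintype T]

/-- The set of objective values of feasible nonanticipative families. -/
def pbpValues (E : Finset (I × T)) (p : I × T → ℝ) (r : I → ℝ) (c : I → ℕ) : Set ℝ :=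
  { v : ℝ | ∃ x : ↥E → (↥E → Bool) → ℝ,
    (∀ e ω, 0 ≤ x e ω ∧ x e ω ≤ 1) ∧
    (∀ (e : ↥E) (ω ω' : ↥E → Bool),
      (∀ e' : ↥E, e'.val.2 < e.val.2 → ω e' = ω' e') → x e ω = x e ω') ∧
    (∀ (i : I) (ω : ↥E → Bool),
      ∑ e ∈ univ.filter (fun e : ↥E => e.val.1 = i),
        x e ω * (if ω e then (1 : ℝ) else 0) ≤ (c i : ℝ)) ∧
    (∀ (t : T) (ω : ↥E → Bool),
      ∑ e ∈ univ.filter (fun e : ↥E => e.val.2 = t), x e ω ≤ 1) ∧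
    v = pExp E p (fun ω => ∑ e : ↥E, r e.val.1 * x e ω * (if ω e then (1 : ℝ) else 0)) }

theorem zero_mem_pbpValues : (0 : ℝ) ∈ pbpValues E p r c :=
  ⟨fun _ _ => 0, by simp, by simp, by simp, by simp, by simp [pExp_const]⟩

/-- The mean of a feasible nonanticipative family is a feasible LP solution of equal value. -/
theorem pbpValues_subset_lpValues (hp : ∀ e ∈ E, 0 ≤ p e ∧ p e ≤ 1) :
    pbpValues E p r c ⊆ lpValues E p r c := by
  rintro v ⟨x, hx, hna, hcap, htime, rfl⟩
  have hind : ∀ e : ↥E, pExp E p (fun ω => x e ω * (if ω e then (1 : ℝ) else 0)) =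
      p e.val * pExp E p (x e) := by
    refine fun e => pExp_mul_indicator E p e (x e) fun ω b => hna e _ _ fun e' he' => ?_
    rw [Function.update_of_ne]
    rintro rfl
    exact lt_irrefl _ he'
  refine ⟨fun e => pExp E p (x e), fun e => ⟨?_, ?_⟩, fun i => ?_, fun t => ?_, ?_⟩
  · simpa [pExp_const] using pExp_mono hp fun ω => (hx e ω).1
  · simpa [pExp_const] using pExp_mono hp fun ω => (hx e ω).2
  · simpa only [pExp_const, pExp_sum, hind] using pExp_mono hp (hcap i)
  · simpa only [pExp_const, pExp_sum] using pExp_mono hp (htime t)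
  · simp only [pExp_sum, mul_assoc, pExp_const_mul, hind]
    exact sum_congr rfl fun e _ => by ring

/-- Scaling an LP solution by `1 - 2 / q` and serving a resource only while the scaled solution
has requested at most `c i - 1` of it loses at most a fraction `3 / q` of the LP value. -/
theorem exists_pbpValues_ge (hp : ∀ e ∈ E, 0 ≤ p e ∧ p e ≤ 1) (hr : ∀ i, 0 ≤ r i) {q : ℝ}
    (hq : 2 ≤ q) (hqc : ∀ i, q ^ 2 ≤ c i) {v : ℝ} (hv : v ∈ lpValues E p r c) :
    ∃ w ∈ pbpValues E p r c, v * (1 - 3 / q) ≤ w := by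
  obtain ⟨x, hx, hcap, htime, rfl⟩ := hv
  have hq0 : 0 < q := by linarith
  set k : ℝ := 1 - 2 / q with hk
  have hk0 : 0 ≤ k := by
    have : 2 / q ≤ 1 := (div_le_one hq0).2 hq
    linarith
  have hk1 : k ≤ 1 := by
    have : 0 ≤ 2 / q := by positivity
    linarith
  have hy : ∀ e, 0 ≤ k * x e ∧ k * x e ≤ 1 := fun e =>
    ⟨mul_nonneg hk0 (hx e).1, mul_le_one₀ hk1 (hx e).1 (hx e).2⟩
  let R : I → Finset ↥E := fun i => univ.filter fun e : ↥E => e.val.1 = i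
  let z : (↥E → Bool) → ↥E → ℝ := fun ω e => k * x e * (if ω e then (1 : ℝ) else 0)
  let X : ↥E → (↥E → Bool) → ℝ := fun e ω =>
    if ∑ b ∈ R e.val.1 with b.val.2 < e.val.2, z ω b ≤ (c e.val.1 : ℝ) - 1 then k * x e else 0
  have hz : ∀ ω e, 0 ≤ z ω e ∧ z ω e ≤ 1 := by
    intro ω e
    have := hy e
    simp only [z]
    split_ifs <;> simp [this]
  have hX0 : ∀ e ω, 0 ≤ X e ω := by
    intro e ω
    simp only [X]
    split_ifs
    exacts [(hy e).1, le_rfl]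
  have hXx : ∀ e ω, X e ω ≤ x e := by
    intro e ω
    simp only [X]
    split_ifs
    exacts [mul_le_of_le_one_left (hx e).1 hk1, (hx e).1]
  have hsum : ∀ i ω, ∑ e ∈ R i, X e ω * (if ω e then (1 : ℝ) else 0) =
      ∑ e ∈ R i, if ∑ b ∈ R i with b.val.2 < e.val.2, z ω b ≤ (c i : ℝ) - 1 then z ω e
        else 0 := by
    intro i ω
    refine sum_congr rfl fun e he => ?_
    obtain rfl : e.val.1 = i := (mem_filter.1 he).2
    simp only [X, ite_mul, zero_mul]
    rfl
  refine ⟨_, ⟨X, fun e ω => ⟨hX0 e ω, (hXx e ω).trans (hx e).2⟩, ?_, ?_, ?_, rfl⟩, ?_⟩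
  · intro e ω ω' h
    have : ∑ b ∈ R e.val.1 with b.val.2 < e.val.2, z ω b =
        ∑ b ∈ R e.val.1 with b.val.2 < e.val.2, z ω' b :=
      sum_congr rfl fun b hb => by simp only [z, h b (mem_filter.1 hb).2]
    simp only [X, this]
  · intro i ω
    refine (hsum i ω).trans_le (truncated_sum_le (R i) (fun e => e.val.2) (z ω) _ ?_
      (fun e _ => hz ω e) (Nat.cast_nonneg _))
    intro a ha b hb hab
    exact Subtype.ext (Prod.ext
      ((mem_filter.1 ha).2.trans (mem_filter.1 hb).2.symm) hab)
  · exact fun t ω => (sum_le_sum fun e _ => hXx e ω).trans (htime t)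
  · have hmain : ∀ i, (1 - 3 / q) * ∑ e ∈ R i, p e.val * x e ≤
        pExp E p (fun ω => ∑ e ∈ R i, X e ω * (if ω e then (1 : ℝ) else 0)) := by
      intro i
      set μ : ℝ := ∑ e ∈ R i, p e.val * (k * x e) with hμ
      have hμk : μ = k * ∑ e ∈ R i, p e.val * x e := by
        rw [hμ, mul_sum]
        exact sum_congr rfl fun e _ => by ring
      have hA : 0 ≤ ∑ e ∈ R i, p e.val * x e :=
        sum_nonneg fun e _ => mul_nonneg (hp e.val e.property).1 (hx e).1
      have hgap : μ + q ≤ (c i : ℝ) - 1 := by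
        have h1 : μ ≤ k * c i := hμk ▸ mul_le_mul_of_nonneg_left (hcap i) hk0
        have h2 : 2 * q ≤ 2 / q * c i := by
          rw [div_mul_eq_mul_div, le_div_iff₀ hq0]
          nlinarith [hqc i]
        have h3 : k * c i = c i - 2 / q * c i := by rw [hk]; ring
        linarith
      have hvar : pExp E p (fun ω => (∑ e ∈ R i, z ω e - μ) ^ 2) ≤ μ := by
        refine (pExp_weighted_sum_sub_sq E p (R i) fun e => k * x e).trans_le ?_
        refine sum_le_sum fun e _ => ?_
        obtain ⟨hp0, hp1⟩ := hp e.val e.property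
        obtain ⟨hy0, hy1⟩ := hy e
        calc (k * x e) ^ 2 * (p e.val * (1 - p e.val))
            ≤ (k * x e) * p e.val := by
              refine mul_le_mul ?_ ?_ (mul_nonneg hp0 (by linarith)) hy0
              · nlinarith
              · nlinarith
          _ = p e.val * (k * x e) := mul_comm _ _
      have hlow : pExp E p (fun ω => ∑ e ∈ R i, z ω e +
            (-(1 / (4 * q))) * (∑ e ∈ R i, z ω e - μ) ^ 2) ≤
          pExp E p (fun ω => ∑ e ∈ R i, X e ω * (if ω e then (1 : ℝ) else 0)) := by
        refine pExp_mono hp fun ω => ?_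
        rw [hsum]
        refine le_trans ?_ (min_le_truncated_sum (R i) (fun e => e.val.2) (z ω) _
          fun e _ => (hz ω e).1)
        refine le_trans (le_of_eq ?_) (sub_sq_div_le_min hq0 hgap)
        ring
      rw [pExp_add, pExp_const_mul, pExp_weighted_sum E p (R i) fun e => k * x e] at hlow
      refine le_trans ?_ hlow
      have h4 : 1 / (4 * q) * pExp E p (fun ω => (∑ e ∈ R i, z ω e - μ) ^ 2) ≤
          1 / (4 * q) * μ := mul_le_mul_of_nonneg_left hvar (by positivity)
      have h5 : 1 - 3 / q ≤ k * (1 - 1 / (4 * q)) := by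
        have : k * (1 - 1 / (4 * q)) - (1 - 3 / q) = 3 / (4 * q) + 1 / (2 * q ^ 2) := by
          rw [hk]; field_simp; ring
        have : 0 ≤ 3 / (4 * q) + 1 / (2 * q ^ 2) := by positivity
        linarith
      have h6 := mul_le_mul_of_nonneg_right h5 hA
      have h7 : k * (1 - 1 / (4 * q)) * ∑ e ∈ R i, p e.val * x e = μ - 1 / (4 * q) * μ := by
        rw [hμk]; ring
      rw [← hμ]
      linarith
    have hval : pExp E p (fun ω => ∑ e : ↥E,
          r e.val.1 * X e ω * (if ω e then (1 : ℝ) else 0)) =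
        ∑ i, r i * pExp E p (fun ω => ∑ e ∈ R i, X e ω * (if ω e then (1 : ℝ) else 0)) := by
      simp only [← pExp_const_mul, ← pExp_sum]
      congr 1
      funext ω
      rw [← sum_fiberwise univ (fun e : ↥E => e.val.1)]
      refine sum_congr rfl fun i _ => ?_
      rw [mul_sum]
      refine sum_congr rfl fun e he => ?_
      rw [(mem_filter.1 he).2, mul_assoc]
    have hlp : ∑ e : ↥E, p e.val * r e.val.1 * x e = ∑ i, r i * ∑ e ∈ R i, p e.val * x e := by
      rw [← sum_fiberwise univ (fun e : ↥E => e.val.1)]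
      refine sum_congr rfl fun i _ => ?_
      rw [mul_sum]
      refine sum_congr rfl fun e he => ?_
      rw [(mem_filter.1 he).2]
      ring
    rw [hval, hlp, sum_mul]
    refine sum_le_sum fun i _ => ?_
    calc _ = r i * ((1 - 3 / q) * ∑ e ∈ R i, p e.val * x e) := by ring
      _ ≤ _ := mul_le_mul_of_nonneg_left (hmain i) (hr i)

theorem pbpOpt_le_lpOpt (hp : ∀ e ∈ E, 0 ≤ p e ∧ p e ≤ 1) (hr : ∀ i, 0 ≤ r i) :
    pbpOpt E p r c ≤ lpOpt E p r c :=
  csSup_le_csSup (bddAbove_lpValues hp hr) ⟨0, zero_mem_pbpValues⟩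
    (pbpValues_subset_lpValues hp)

theorem lpOpt_mul_le_pbpOpt (hp : ∀ e ∈ E, 0 ≤ p e ∧ p e ≤ 1) (hr : ∀ i, 0 ≤ r i) {q : ℝ}
    (hq : 0 < q) (hqc : ∀ i, q ^ 2 ≤ c i) :
    lpOpt E p r c * (1 - 3 / q) ≤ pbpOpt E p r c := by
  have hbdd : BddAbove (pbpValues E p r c) :=
    (bddAbove_lpValues hp hr).mono (pbpValues_subset_lpValues hp)
  have hlp : 0 ≤ lpOpt E p r c := le_csSup (bddAbove_lpValues hp hr) zero_mem_lpValues
  have hpbp : 0 ≤ pbpOpt E p r c := le_csSup hbdd zero_mem_pbpValues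
  rcases le_or_gt q 3 with hq3 | hq3
  · have : 1 ≤ 3 / q := (one_le_div hq).2 hq3
    exact (mul_nonpos_of_nonneg_of_nonpos hlp (by linarith)).trans hpbp
  · have hpos : 0 < 1 - 3 / q := sub_pos.2 ((div_lt_one hq).2 hq3)
    rw [← le_div_iff₀ hpos]
    refine csSup_le ⟨0, zero_mem_lpValues⟩ fun v hv => ?_
    obtain ⟨w, hw, hvw⟩ := exists_pbpValues_ge hp hr (by linarith) hqc hv
    exact (le_div_iff₀ hpos).2 (hvw.trans (le_csSup hbdd hw))

end Programs

theorem three_div_sqrt_le {m : ℝ} (hm : 2 ≤ m) :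
    3 / √m ≤ 4 * √(Real.log m / m) := by
  have hlog : (3 / 4 : ℝ) ≤ √(Real.log m) := by
    refine Real.le_sqrt_of_sq_le ?_
    have h1 := Real.log_two_gt_d9
    have h2 := Real.log_le_log (by norm_num) hm
    norm_num
    linarith
  rw [Real.sqrt_div' _ (by linarith), ← mul_div_assoc]
  gcongr
  linarith

/-- there is a universal constant `C ≥ 0` such that for every finite
bipartite instance with capacities satisfying `c_min := min_i c_i ≥ 2`,
`OPT(LP)·(1 - C·√(log c_min / c_min)) ≤ OPT(PBP) ≤ OPT(LP)`. -/
theorem stmt3 : ∃ C : ℝ, 0 ≤ C ∧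
    ∀ (I T : Type) [Fintype I] [DecidableEq I] [Fintype T] [LinearOrder T]
      (E : Finset (I × T)) (p : I × T → ℝ) (r : I → ℝ) (c : I → ℕ),
      (∀ e ∈ E, 0 ≤ p e ∧ p e ≤ 1) → (∀ i, 0 ≤ r i) → (∀ i, 1 ≤ c i) →
      ∀ hne : (univ : Finset I).Nonempty,
        2 ≤ univ.inf' hne c →
        lpOpt E p r c *
            (1 - C * Real.sqrt (Real.log ((univ.inf' hne c : ℕ) : ℝ) / ((univ.inf' hne c : ℕ) : ℝ))) ≤
          pbpOpt E p r c ∧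
        pbpOpt E p r c ≤ lpOpt E p r c := by
  refine ⟨4, by norm_num, ?_⟩
  intro I T _ _ _ _ E p r c hp hr _ hne hm
  refine ⟨?_, pbpOpt_le_lpOpt hp hr⟩
  have hm' : (2 : ℝ) ≤ ((univ.inf' hne c : ℕ) : ℝ) := by exact_mod_cast hm
  have hlp : 0 ≤ lpOpt E p r c := le_csSup (bddAbove_lpValues hp hr) zero_mem_lpValues
  refine le_trans (mul_le_mul_of_nonneg_left (sub_le_sub_left (three_div_sqrt_le hm') 1) hlp)
    (lpOpt_mul_le_pbpOpt hp hr (Real.sqrt_pos.2 (by linarith)) fun i => ?_)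
  rw [Real.sq_sqrt (by linarith)]
  exact_mod_cast inf'_le c (mem_univ i)
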